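/- Let k and a be integers with 1 ≤ a ≤ k and k ≡ a (mod 2). For a nonnegative integer n, let W_{k,a}(n) denote the number of partitions λ of n such that f_1(λ) ≤ a−1, f_i(λ)+f_{i+1}(λ) ≤ k−1 for every i ≥ 1, and every even part appears an even number of times (i.e., f_{2j}(λ) is even for all j ≥ 1). Then for every complex number q with |q| < 1, ∑_{n ≥ 0} W_{k,a}(n) q^n = (−q; q²)_∞ (q^a, q^{2k+2−a}, q^{2k+2}; q^{2k+2})_∞ / (q²; q²)_∞. -/

import Mathlib

open Finset

/-- Finite q-Pochhammer symbol `(x;q)_n`. -/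
noncomputable def qPoch (q x : ℂ) (n : ℕ) : ℂ :=
  ∏ j ∈ Finset.range n, (1 - x * q ^ j)

/-- Infinite q-Pochhammer symbol `(x;q)_∞`. -/
noncomputable def qPochInf (q x : ℂ) : ℂ :=
  ∏' j : ℕ, (1 - x * q ^ j)
open Filter Topology

theorem summable_mul_pow_complex {q : ℂ} (hq : ‖q‖ < 1) (x : ℂ) :
    Summable fun j : ℕ => ‖-(x * q ^ j)‖ := by
  simp only [norm_neg, norm_mul, norm_pow]
  exact (summable_geometric_of_lt_one (norm_nonneg q) hq).mul_left _

theorem qPoch_tendsto {q : ℂ} (hq : ‖q‖ < 1) (x : ℂ) :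
    Tendsto (qPoch q x) atTop (𝓝 (qPochInf q x)) := by
  have h := multipliable_one_add_of_summable (summable_mul_pow_complex hq x)
  simp only [← sub_eq_add_neg] at h
  exact h.hasProd.tendsto_prod_nat

theorem norm_mul_pow_lt_one {q x : ℂ} (hq : ‖q‖ < 1) (hx : ‖x‖ < 1) (j : ℕ) :
    ‖x * q ^ j‖ < 1 := by
  rw [norm_mul, norm_pow]
  calc ‖x‖ * ‖q‖ ^ j ≤ ‖x‖ * 1 := by gcongr; exact pow_le_one₀ (norm_nonneg q) hq.le
    _ < 1 := by simpa using hx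

theorem one_sub_mul_pow_ne_zero {q x : ℂ} (hq : ‖q‖ < 1) (hx : ‖x‖ < 1) (j : ℕ) :
    1 - x * q ^ j ≠ 0 := by
  intro h
  have h1 := norm_mul_pow_lt_one hq hx j
  rw [← sub_eq_zero.mp h] at h1
  simp at h1

theorem qPoch_ne_zero {q x : ℂ} (hq : ‖q‖ < 1) (hx : ‖x‖ < 1) (n : ℕ) : qPoch q x n ≠ 0 :=
  Finset.prod_ne_zero_iff.mpr fun j _ => one_sub_mul_pow_ne_zero hq hx j

theorem qPochInf_ne_zero {q x : ℂ} (hq : ‖q‖ < 1) (hx : ‖x‖ < 1) : qPochInf q x ≠ 0 := by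
  have h := tprod_one_add_ne_zero_of_summable (f := fun j : ℕ => -(x * q ^ j))
    (fun j => by simpa [← sub_eq_add_neg] using one_sub_mul_pow_ne_zero hq hx j)
    (summable_mul_pow_complex hq x)
  simp only [← sub_eq_add_neg] at h
  exact h

theorem exists_norm_le_of_tendsto {u : ℕ → ℂ} {l : ℂ} (h : Tendsto u atTop (𝓝 l)) :
    ∃ C : ℝ, 0 ≤ C ∧ ∀ n, ‖u n‖ ≤ C := by
  obtain ⟨C, hC⟩ := (Metric.isBounded_range_of_tendsto u h).exists_norm_le
  exact ⟨C, (norm_nonneg _).trans (hC (u 0) ⟨0, rfl⟩), fun n => hC _ ⟨n, rfl⟩⟩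

theorem qPoch_succ (q x : ℂ) (n : ℕ) : qPoch q x (n + 1) = qPoch q x n * (1 - x * q ^ n) :=
  Finset.prod_range_succ _ _

/-- The Gaussian binomial coefficient `[M; j]` in the base `p`. -/
noncomputable def gaussBinom (p : ℂ) (M j : ℕ) : ℂ :=
  qPoch p p M / (qPoch p p j * qPoch p p (M - j))

theorem gaussBinom_self {p : ℂ} (hp : ‖p‖ < 1) (M : ℕ) : gaussBinom p M M = 1 := by
  have h := qPoch_ne_zero hp hp M
  have h0 : qPoch p p 0 = 1 := by simp [qPoch]
  rw [gaussBinom, Nat.sub_self, h0, mul_one, div_self h]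

theorem gaussBinom_zero {p : ℂ} (hp : ‖p‖ < 1) (M : ℕ) : gaussBinom p M 0 = 1 := by
  have h := qPoch_ne_zero hp hp M
  have h0 : qPoch p p 0 = 1 := by simp [qPoch]
  rw [gaussBinom, Nat.sub_zero, h0, one_mul, div_self h]

theorem gaussBinom_pascal {p : ℂ} (hp : ‖p‖ < 1) {M j : ℕ} (hj : j < M) :
    gaussBinom p (M + 1) (j + 1) =
      gaussBinom p M (j + 1) + p ^ (M - j) * gaussBinom p M j := by
  obtain ⟨d, rfl⟩ : ∃ d, M = j + 1 + d := ⟨M - (j + 1), by omega⟩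
  have e1 : j + 1 + d + 1 - (j + 1) = d + 1 := by omega
  have e2 : j + 1 + d - (j + 1) = d := by omega
  have e3 : j + 1 + d - j = d + 1 := by omega
  simp only [gaussBinom, e1, e2, e3, qPoch_succ p p (j + 1 + d), qPoch_succ p p j,
    qPoch_succ p p d]
  have hA := qPoch_ne_zero hp hp j
  have hB := qPoch_ne_zero hp hp d
  have h1 := one_sub_mul_pow_ne_zero hp hp j
  have h2 := one_sub_mul_pow_ne_zero hp hp d
  field_simp
  ring

theorem choose_two_succ (n : ℕ) : (n + 1).choose 2 = n + n.choose 2 := by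
  rw [Nat.choose_succ_succ' n 1, Nat.choose_one_right]

/-- Cauchy's `q`-binomial theorem in homogeneous form. -/
theorem prod_sub_mul_pow_eq_sum {p : ℂ} (hp : ‖p‖ < 1) (u v : ℂ) (M : ℕ) :
    ∏ j ∈ Finset.range M, (u - v * p ^ j) =
      ∑ j ∈ Finset.range (M + 1),
        gaussBinom p M j * p ^ j.choose 2 * (-v) ^ j * u ^ (M - j) := by
  induction M with
  | zero => simp [gaussBinom, qPoch]
  | succ M ih =>
    rw [Finset.prod_range_succ, ih, Finset.sum_range_succ (n := M + 1),
      Finset.sum_range_succ' (n := M)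
        (f := fun j => gaussBinom p (M + 1) j * p ^ j.choose 2 * (-v) ^ j * u ^ (M + 1 - j)),
      mul_sub, Finset.sum_mul, Finset.sum_mul,
      Finset.sum_range_succ' (n := M), Finset.sum_range_succ (n := M)
        (f := fun j => gaussBinom p M j * p ^ j.choose 2 * (-v) ^ j * u ^ (M - j) * (v * p ^ M))]
    have key : ∀ j ∈ Finset.range M,
        gaussBinom p (M + 1) (j + 1) * p ^ (j + 1).choose 2 * (-v) ^ (j + 1) *
            u ^ (M + 1 - (j + 1)) =
          gaussBinom p M (j + 1) * p ^ (j + 1).choose 2 * (-v) ^ (j + 1) *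
            u ^ (M - (j + 1)) * u -
          gaussBinom p M j * p ^ j.choose 2 * (-v) ^ j * u ^ (M - j) * (v * p ^ M) := by
      intro j hj
      have hj' := Finset.mem_range.mp hj
      rw [gaussBinom_pascal hp hj']
      obtain ⟨d, rfl⟩ : ∃ d, M = j + 1 + d := ⟨M - (j + 1), by omega⟩
      have e1 : j + 1 + d + 1 - (j + 1) = d + 1 := by omega
      have e2 : j + 1 + d - (j + 1) = d := by omega
      have e3 : j + 1 + d - j = d + 1 := by omega
      rw [e1, e2, e3, choose_two_succ]
      ring
    rw [Finset.sum_congr rfl key, Finset.sum_sub_distrib]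
    rw [gaussBinom_self hp, gaussBinom_self hp, gaussBinom_zero hp, gaussBinom_zero hp,
      choose_two_succ]
    simp only [Nat.sub_self, Nat.sub_zero]
    ring

theorem choose_two_mul_two_add (n : ℕ) : n.choose 2 * 2 + n = n ^ 2 := by
  induction n with
  | zero => simp
  | succ n ih => rw [choose_two_succ]; nlinarith

theorem choose_two_add (m n : ℕ) : (m + n).choose 2 = m.choose 2 + n.choose 2 + m * n := by
  induction n with
  | zero => simp
  | succ n ih => rw [← add_assoc, choose_two_succ, choose_two_succ, ih]; ring

theorem prod_range_pow_id (p : ℂ) (N : ℕ) : ∏ j ∈ Finset.range N, p ^ j = p ^ N.choose 2 := by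
  induction N with
  | zero => simp
  | succ n ih => rw [Finset.prod_range_succ, ih, choose_two_succ, pow_add, mul_comm]

/-- The finite form of the Jacobi triple product. -/
theorem qPoch_mul_qPoch_eq_sum {p x y : ℂ} (hp : ‖p‖ < 1) (hp0 : p ≠ 0) (hxy : x * y = p)
    (N : ℕ) :
    qPoch p x N * qPoch p y N =
      ∑ n ∈ Finset.range (N + 1), (-1) ^ n * gaussBinom p (2 * N) (N + n) *
        (p ^ n.choose 2 * y ^ n) -
      ∑ n ∈ Finset.range N, (-1) ^ n * gaussBinom p (2 * N) (N - 1 - n) *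
        (p ^ (n + 1).choose 2 * x ^ (n + 1)) := by
  have hy0 : y ≠ 0 := by rintro rfl; exact hp0 (by simpa using hxy.symm)
  have h := prod_sub_mul_pow_eq_sum hp (p ^ N) y (2 * N)
  have hc : (-y) ^ N * p ^ (N.choose 2 + N * N) ≠ 0 :=
    mul_ne_zero (pow_ne_zero _ (neg_ne_zero.mpr hy0)) (pow_ne_zero _ hp0)
  have e1 : ∏ j ∈ Finset.range (2 * N), (p ^ N - y * p ^ j) =
      (-y) ^ N * p ^ (N.choose 2 + N * N) * (qPoch p x N * qPoch p y N) := by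
    rw [two_mul, Finset.prod_range_add, ← Finset.prod_range_reflect]
    have h1 : ∀ j ∈ Finset.range N, p ^ N - y * p ^ (N - 1 - j) =
        (-y) * p ^ (N - 1 - j) * (1 - x * p ^ j) := by
      intro j hj
      obtain ⟨d, rfl⟩ : ∃ d, N = j + 1 + d :=
        ⟨N - (j + 1), by have := Finset.mem_range.mp hj; omega⟩
      have : j + 1 + d - 1 - j = d := by omega
      rw [this]
      calc p ^ (j + 1 + d) - y * p ^ d = p * p ^ j * p ^ d - y * p ^ d := by ring
        _ = _ := by rw [← hxy]; ring
    have h2 : ∀ j ∈ Finset.range N, p ^ N - y * p ^ (N + j) = p ^ N * (1 - y * p ^ j) := by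
      intro j _; ring
    rw [Finset.prod_congr rfl h1, Finset.prod_congr rfl h2]
    simp only [Finset.prod_mul_distrib, Finset.prod_const, Finset.card_range]
    rw [Finset.prod_range_reflect (fun j => p ^ j), prod_range_pow_id, qPoch, qPoch]
    ring
  have e2 : 2 * N + 1 = N + (N + 1) := by ring
  rw [e1, e2, Finset.sum_range_add, ← Finset.sum_range_reflect] at h
  apply mul_left_cancel₀ hc
  rw [h, mul_sub, Finset.mul_sum, Finset.mul_sum, sub_eq_add_neg, add_comm,
    ← Finset.sum_neg_distrib]
  congr 1
  · refine Finset.sum_congr rfl fun n hn => ?_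
    obtain ⟨d, rfl⟩ : ∃ d, N = n + d := ⟨N - n, by have := Finset.mem_range.mp hn; omega⟩
    have e3 : 2 * (n + d) - (n + d + n) = d := by omega
    rw [e3, choose_two_add (n + d) n, ← pow_mul]
    ring
  · refine Finset.sum_congr rfl fun n hn => ?_
    obtain ⟨d, rfl⟩ : ∃ d, N = n + 1 + d :=
      ⟨N - (n + 1), by have := Finset.mem_range.mp hn; omega⟩
    have e3 : n + 1 + d - 1 - n = d := by omega
    have e4 : 2 * (n + 1 + d) - d = n + 1 + (n + 1) + d := by omega
    rw [e3, e4, choose_two_add (n + 1) d, ← pow_mul]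
    have e5 := (choose_two_mul_two_add (n + 1)).symm
    have e6 : (n + 1 + d) * (n + 1 + (n + 1) + d) =
        (n + 1 + d) * (n + 1 + d) + (n + 1) ^ 2 + (n + 1) * d := by ring
    have e7 : x ^ (n + 1) * y ^ (n + 1) = p ^ (n + 1) := by rw [← mul_pow, hxy]
    rw [e6, e5]
    calc _ = gaussBinom p (2 * (n + 1 + d)) d * (-y) ^ d *
          p ^ ((n + 1).choose 2 * 2 + (n + 1) * d + d.choose 2 + (n + 1 + d) * (n + 1 + d)) *
            p ^ (n + 1) * ((-1) ^ (n + 1) * (-1) ^ (n + 1)) := by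
          rw [← mul_pow]; ring_nf
      _ = _ := by
        rw [← e7]
        have : (-y) ^ (n + 1 + d) = (-1) ^ (n + 1) * y ^ (n + 1) * (-y) ^ d := by
          rw [pow_add, neg_pow]
        rw [this]; ring

theorem gaussBinom_bounded {p : ℂ} (hp : ‖p‖ < 1) :
    ∃ C : ℝ, 0 ≤ C ∧ ∀ M j, ‖gaussBinom p M j‖ ≤ C := by
  obtain ⟨A, hA, hA'⟩ := exists_norm_le_of_tendsto (qPoch_tendsto hp p)
  obtain ⟨B, hB, hB'⟩ :=
    exists_norm_le_of_tendsto ((qPoch_tendsto hp p).inv₀ (qPochInf_ne_zero hp hp))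
  refine ⟨A * (B * B), by positivity, fun M j => ?_⟩
  rw [gaussBinom, div_eq_mul_inv, mul_inv, norm_mul, norm_mul]
  gcongr
  exacts [hA' M, hB' j, hB' (M - j)]

theorem gaussBinom_tendsto {p : ℂ} (hp : ‖p‖ < 1) {u v : ℕ → ℕ}
    (hu : Tendsto u atTop atTop) (hv : Tendsto v atTop atTop)
    (hvu : Tendsto (fun N => u N - v N) atTop atTop) :
    Tendsto (fun N => gaussBinom p (u N) (v N)) atTop (𝓝 (qPochInf p p)⁻¹) := by
  have h0 := qPochInf_ne_zero hp hp
  have ht := qPoch_tendsto hp p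
  have := (ht.comp hu).div ((ht.comp hv).mul (ht.comp hvu)) (mul_ne_zero h0 h0)
  have e : qPochInf p p / (qPochInf p p * qPochInf p p) = (qPochInf p p)⁻¹ := by field_simp
  rw [e] at this
  exact this

/-- The Jacobi triple product identity, folded to a sum over `ℕ`. -/
theorem jacobi_triple_product {p x y : ℂ} (hp : ‖p‖ < 1) (hp0 : p ≠ 0) (hx : ‖x‖ < 1)
    (hy : ‖y‖ < 1) (hxy : x * y = p) :
    ∑' n : ℕ, (-1) ^ n * (p ^ n.choose 2 * y ^ n - p ^ (n + 1).choose 2 * x ^ (n + 1)) =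
      qPochInf p x * qPochInf p y * qPochInf p p := by
  have h0 := qPochInf_ne_zero hp hp
  let T : ℕ → ℕ → ℂ := fun N n => (-1) ^ n *
    ((if n < N + 1 then gaussBinom p (2 * N) (N + n) else 0) * (p ^ n.choose 2 * y ^ n) -
      (if n < N then gaussBinom p (2 * N) (N - 1 - n) else 0) *
        (p ^ (n + 1).choose 2 * x ^ (n + 1)))
  have hT : ∀ N, ∑' n, T N n = qPoch p x N * qPoch p y N := by
    intro N
    rw [qPoch_mul_qPoch_eq_sum hp hp0 hxy, tsum_eq_sum (s := Finset.range (N + 1))]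
    · simp only [T, mul_sub, Finset.sum_sub_distrib]
      congr 1
      · refine Finset.sum_congr rfl fun n hn => ?_
        rw [if_pos (Finset.mem_range.mp hn)]; ring
      · rw [Finset.sum_range_succ, if_neg (lt_irrefl N), zero_mul, mul_zero, add_zero]
        refine Finset.sum_congr rfl fun n hn => ?_
        rw [if_pos (Finset.mem_range.mp hn)]; ring
    · intro n hn
      have hn' : ¬ n < N + 1 := by simpa using hn
      have hn'' : ¬ n < N := by omega
      simp only [T, if_neg hn', if_neg hn'', zero_mul, sub_zero, mul_zero]
  obtain ⟨C, hC, hC'⟩ := gaussBinom_bounded hp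
  have hlim : Tendsto (fun N => ∑' n, T N n) atTop
      (𝓝 (∑' n : ℕ, (-1) ^ n * ((qPochInf p p)⁻¹ * (p ^ n.choose 2 * y ^ n) -
        (qPochInf p p)⁻¹ * (p ^ (n + 1).choose 2 * x ^ (n + 1))))) := by
    refine tendsto_tsum_of_dominated_convergence
      (bound := fun n => C * ‖y‖ ^ n + C * ‖x‖ ^ n) ?_ ?_ ?_
    · exact ((summable_geometric_of_lt_one (norm_nonneg _) hy).mul_left C).add
        ((summable_geometric_of_lt_one (norm_nonneg _) hx).mul_left C)
    · intro n
      refine Tendsto.const_mul _ (Tendsto.sub (Tendsto.mul_const _ ?_) (Tendsto.mul_const _ ?_))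
      · refine (gaussBinom_tendsto hp (u := fun N => 2 * N) (v := fun N => N + n)
          ?_ ?_ ?_).congr' ?_
        · exact tendsto_id.const_mul_atTop' (by norm_num)
        · exact tendsto_add_atTop_nat n
        · refine (tendsto_sub_atTop_nat n).congr fun N => by omega
        · filter_upwards [eventually_gt_atTop n] with N hN
          rw [if_pos (by omega)]
      · refine (gaussBinom_tendsto hp (u := fun N => 2 * N) (v := fun N => N - 1 - n)
          ?_ ?_ ?_).congr' ?_
        · exact tendsto_id.const_mul_atTop' (by norm_num)
        · refine (tendsto_sub_atTop_nat (1 + n)).congr fun N => by omega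
        · refine tendsto_atTop_mono (fun N => ?_) tendsto_id
          simp only [id]; omega
        · filter_upwards [eventually_gt_atTop n] with N hN
          rw [if_pos (by omega)]
    · refine Eventually.of_forall fun N n => ?_
      have hb : ∀ (c : Prop) [Decidable c] (j : ℕ),
          ‖(if c then gaussBinom p (2 * N) j else 0)‖ ≤ C := by
        intro c _ j
        split_ifs
        · exact hC' _ _
        · simpa using hC
      have h1 : ∀ j, ‖p‖ ^ j ≤ 1 := fun j => pow_le_one₀ (norm_nonneg p) hp.le
      have h2 : ‖x‖ ^ (n + 1) ≤ ‖x‖ ^ n := pow_le_pow_of_le_one (norm_nonneg x) hx.le (by omega)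
      simp only [T, norm_mul, norm_pow, norm_neg, norm_one, one_pow, one_mul]
      refine (norm_sub_le _ _).trans ?_
      simp only [norm_mul, norm_pow]
      gcongr
      · exact hb _ _
      · exact mul_le_of_le_one_left (by positivity) (h1 _)
      · exact hb _ _
      · exact (mul_le_of_le_one_left (by positivity) (h1 _)).trans h2
  have hlim2 := ((qPoch_tendsto hp x).mul (qPoch_tendsto hp y)).congr fun N => (hT N).symm
  rw [tendsto_nhds_unique hlim2 hlim, ← tsum_mul_right]
  refine tsum_congr fun n => ?_
  field_simp

/-- The `n`-th term of the series `thetaSeries k q m a`. -/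
noncomputable def thetaTerm (k : ℕ) (q : ℂ) (m a n : ℕ) : ℂ :=
  (-1) ^ n * qPoch (q ^ 2) (q ^ (2 * n + 2)) m *
    (q ^ ((k + 1) * n ^ 2 + n + (m + 1) * k * n - a * n) -
      q ^ ((k + 1) * n ^ 2 + n + (m + 1) * k * n + a * (n + m + 1)))

/-- A partial-theta deformation of the Jacobi theta series, with deformation depth `m`. -/
noncomputable def thetaSeries (k : ℕ) (q : ℂ) (m a : ℕ) : ℂ := ∑' n, thetaTerm k q m a n

theorem qPoch_sq_shift (q : ℂ) (m n : ℕ) :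
    (1 - q ^ (2 * (n + 1))) * qPoch (q ^ 2) (q ^ (2 * (n + 1) + 2)) m =
      qPoch (q ^ 2) (q ^ (2 * n + 2)) (m + 1) := by
  rw [qPoch, qPoch, Finset.prod_range_succ', mul_comm]
  congr 1
  · refine Finset.prod_congr rfl fun j _ => ?_
    ring
  · ring

theorem qPoch_sq_succ (q : ℂ) (m n : ℕ) :
    (1 - q ^ (2 * (n + m + 1))) * qPoch (q ^ 2) (q ^ (2 * n + 2)) m =
      qPoch (q ^ 2) (q ^ (2 * n + 2)) (m + 1) := by
  rw [qPoch_succ, mul_comm]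
  congr 1
  ring

theorem norm_qPoch_le_of_le {p x : ℂ} (hp : ‖p‖ < 1) (hx : ‖x‖ ≤ 1) (m : ℕ) :
    ‖qPoch p x m‖ ≤ Real.exp (1 / (1 - ‖p‖)) := by
  rw [qPoch, norm_prod]
  calc ∏ j ∈ Finset.range m, ‖1 - x * p ^ j‖
      ≤ ∏ j ∈ Finset.range m, Real.exp (‖p‖ ^ j) := by
        refine Finset.prod_le_prod (fun _ _ => norm_nonneg _) fun j _ => ?_
        refine (norm_sub_le _ _).trans ?_
        rw [norm_one, norm_mul, norm_pow, add_comm]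
        refine le_trans ?_ (Real.add_one_le_exp _)
        gcongr
        exact mul_le_of_le_one_left (by positivity) hx
    _ = Real.exp (∑ j ∈ Finset.range m, ‖p‖ ^ j) := (Real.exp_sum _ _).symm
    _ ≤ _ := by
        gcongr
        rw [one_div, ← tsum_geometric_of_lt_one (norm_nonneg p) hp]
        exact (summable_geometric_of_lt_one (norm_nonneg p) hp).sum_le_tsum _
          fun _ _ => by positivity

theorem norm_qPoch_sq_le {q : ℂ} (hq : ‖q‖ < 1) (m n : ℕ) :
    ‖qPoch (q ^ 2) (q ^ (2 * n + 2)) m‖ ≤ Real.exp (1 / (1 - ‖q ^ 2‖)) := by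
  refine norm_qPoch_le_of_le ?_ ?_ m
  · rw [norm_pow]; exact pow_lt_one₀ (norm_nonneg q) hq two_ne_zero
  · rw [norm_pow]; exact pow_le_one₀ (norm_nonneg q) hq.le

theorem summable_qPoch_mul_pow {q : ℂ} (hq : ‖q‖ < 1) (m : ℕ) {e : ℕ → ℕ} (he : ∀ n, n ≤ e n) :
    Summable fun n => (-1) ^ n * qPoch (q ^ 2) (q ^ (2 * n + 2)) m * q ^ e n := by
  refine Summable.of_norm_bounded
    ((summable_geometric_of_lt_one (norm_nonneg q) hq).mul_left
      (Real.exp (1 / (1 - ‖q‖ ^ 2)))) fun n => ?_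
  simp only [norm_mul, norm_pow, norm_neg, norm_one, one_pow, one_mul]
  refine mul_le_mul ?_ ?_ (by positivity) (Real.exp_nonneg _)
  · simpa only [norm_pow] using norm_qPoch_sq_le hq m n
  · exact pow_le_pow_of_le_one (norm_nonneg q) hq.le (he n)

theorem mul_le_mul_sq {a b : ℕ} (h : a ≤ b) (n : ℕ) : a * n ≤ b * n ^ 2 :=
  Nat.mul_le_mul h (Nat.le_self_pow two_ne_zero n)

theorem le_theta_exponent {k a : ℕ} (h : a ≤ k + 1) (m n : ℕ) :
    n ≤ (k + 1) * n ^ 2 + n + (m + 1) * k * n - a * n := by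
  have h1 := mul_le_mul_sq h n
  omega

theorem mul_le_theta_exponent {k a : ℕ} (h : a ≤ k + 1) (m n : ℕ) :
    a * n ≤ (k + 1) * n ^ 2 + n + (m + 1) * k * n := by
  have h1 := mul_le_mul_sq h n
  omega

theorem summable_thetaTerm {k : ℕ} {q : ℂ} (hq : ‖q‖ < 1) {a : ℕ} (h : a ≤ k + 1) (m : ℕ) :
    Summable (thetaTerm k q m a) := by
  have := (summable_qPoch_mul_pow hq m (fun n => le_theta_exponent h m n)).sub
    (summable_qPoch_mul_pow hq m
      (e := fun n => (k + 1) * n ^ 2 + n + (m + 1) * k * n + a * (n + m + 1))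
      (fun n => by omega))
  refine this.congr fun n => ?_
  rw [thetaTerm]; ring

theorem tsum_eq_of_telescope {u α β v : ℕ → ℂ} (hu : ∀ n, u n = α n + β n) (hα : α 0 = 0)
    (hv : ∀ n, α (n + 1) + β n = v n) (hus : Summable u) (hβ : Summable β) :
    ∑' n, u n = ∑' n, v n := by
  have hαs : Summable α := by
    refine (hus.sub hβ).congr fun n => ?_
    rw [hu]; ring
  simp only [hu, ← hv]
  rw [hαs.tsum_add hβ, hαs.tsum_eq_zero_add, hα, zero_add,
    ((summable_nat_add_iff 1).mpr hαs).tsum_add hβ]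

theorem thetaSeries_zero (k : ℕ) (q : ℂ) (m : ℕ) : thetaSeries k q m 0 = 0 := by
  simp [thetaSeries, thetaTerm]

/-- The fundamental recurrence of Rogers–Selberg type. -/
theorem thetaSeries_add_two {k : ℕ} {q : ℂ} (hq : ‖q‖ < 1) {a : ℕ} (h : a + 1 ≤ k) (m : ℕ) :
    thetaSeries k q m (a + 2) - thetaSeries k q m a =
      q ^ ((m + 1) * a) * thetaSeries k q (m + 1) (k - a) := by
  have s2 := summable_thetaTerm hq (show a + 2 ≤ k + 1 by omega) m
  have s0 := summable_thetaTerm hq (show a ≤ k + 1 by omega) m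
  rw [thetaSeries, thetaSeries, thetaSeries, ← s2.tsum_sub s0, ← tsum_mul_left]
  refine tsum_eq_of_telescope
    (α := fun n => (-1) ^ n * qPoch (q ^ 2) (q ^ (2 * n + 2)) m *
      q ^ ((k + 1) * n ^ 2 + n + (m + 1) * k * n - (a + 2) * n) * (1 - q ^ (2 * n)))
    (β := fun n => (-1) ^ n * qPoch (q ^ 2) (q ^ (2 * n + 2)) m *
      q ^ ((k + 1) * n ^ 2 + n + (m + 1) * k * n + a * (n + m + 1)) *
        (1 - q ^ (2 * (n + m + 1)))) ?_ ?_ ?_ (s2.sub s0) ?_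
  · intro n
    have h2 := mul_le_theta_exponent (show a + 2 ≤ k + 1 by omega) m n
    obtain ⟨d, hd⟩ := Nat.exists_eq_add_of_le h2
    simp only [thetaTerm]
    rw [hd]
    have e1 : (a + 2) * n + d - (a + 2) * n = d := by omega
    have e2 : (a + 2) * n + d - a * n = d + 2 * n := by rw [add_mul]; omega
    rw [e1, e2]
    ring
  · simp
  · intro n
    obtain ⟨b, rfl⟩ : ∃ b, k = a + b := ⟨k - a, by omega⟩
    have e0 : a + b - a = b := by omega
    simp only [thetaTerm]
    rw [e0, ← qPoch_sq_succ]
    have e1 : (a + b + 1) * n ^ 2 + n + (m + 1 + 1) * (a + b) * n - b * n =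
        (a + b + 1) * n ^ 2 + n + (m + 1) * (a + b) * n + a * n := by
      apply Nat.sub_eq_of_eq_add; ring
    have e2 : (a + b + 1) * (n + 1) ^ 2 + (n + 1) + (m + 1) * (a + b) * (n + 1) -
        (a + 2) * (n + 1) = (m + 1) * a + ((a + b + 1) * n ^ 2 + n + (m + 1 + 1) * (a + b) * n +
          b * (n + (m + 1) + 1)) := by
      apply Nat.sub_eq_of_eq_add; ring
    rw [e1, e2]
    have e3 := qPoch_sq_shift q m n
    rw [← qPoch_sq_succ] at e3
    have e4 : ∀ z : ℂ, (-1) ^ (n + 1) * qPoch (q ^ 2) (q ^ (2 * (n + 1) + 2)) m * z *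
        (1 - q ^ (2 * (n + 1))) = -((-1) ^ n * ((1 - q ^ (2 * (n + 1))) *
          qPoch (q ^ 2) (q ^ (2 * (n + 1) + 2)) m) * z) := fun z => by ring
    rw [e4, e3]
    ring
  · simp only [mul_sub, mul_one]
    refine Summable.sub (summable_qPoch_mul_pow hq m fun n => ?_) ?_
    · omega
    · simp only [mul_assoc, ← pow_add]
      simp only [← mul_assoc]
      refine summable_qPoch_mul_pow hq m fun n => ?_
      omega

theorem thetaSeries_one {k : ℕ} {q : ℂ} (hq : ‖q‖ < 1) (m : ℕ) :
    (1 + q ^ (m + 1)) * thetaSeries k q m 1 = thetaSeries k q (m + 1) (k + 1) := by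
  have s1 := summable_thetaTerm hq (show 1 ≤ k + 1 by omega) m
  rw [thetaSeries, thetaSeries, ← tsum_mul_left]
  refine tsum_eq_of_telescope
    (α := fun n => (-1) ^ n * qPoch (q ^ 2) (q ^ (2 * n + 2)) m *
      q ^ ((k + 1) * n ^ 2 + (m + 1) * k * n + (m + 1)) * (1 - q ^ (2 * n)))
    (β := fun n => (-1) ^ n * qPoch (q ^ 2) (q ^ (2 * n + 2)) m *
      q ^ ((k + 1) * n ^ 2 + (m + 1) * k * n) *
        (1 - q ^ (2 * (n + m + 1)))) ?_ ?_ ?_ (s1.mul_left _) ?_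
  · intro n
    simp only [thetaTerm]
    have e1 : (k + 1) * n ^ 2 + n + (m + 1) * k * n - 1 * n =
      (k + 1) * n ^ 2 + (m + 1) * k * n := by omega
    rw [e1]
    ring
  · simp
  · intro n
    simp only [thetaTerm]
    rw [← qPoch_sq_succ]
    have e1 : (k + 1) * n ^ 2 + n + (m + 1 + 1) * k * n - (k + 1) * n =
        (k + 1) * n ^ 2 + (m + 1) * k * n := by
      apply Nat.sub_eq_of_eq_add; ring
    rw [e1]
    have e3 := qPoch_sq_shift q m n
    rw [← qPoch_sq_succ] at e3
    have e4 : ∀ z : ℂ, (-1) ^ (n + 1) * qPoch (q ^ 2) (q ^ (2 * (n + 1) + 2)) m * z *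
        (1 - q ^ (2 * (n + 1))) = -((-1) ^ n * ((1 - q ^ (2 * (n + 1))) *
          qPoch (q ^ 2) (q ^ (2 * (n + 1) + 2)) m) * z) := fun z => by ring
    rw [e4, e3]
    ring
  · have hn : ∀ n : ℕ, n ≤ (k + 1) * n ^ 2 := fun n => by
      have := Nat.le_self_pow two_ne_zero n
      nlinarith [Nat.zero_le (k * n ^ 2)]
    simp only [mul_sub, mul_one]
    refine Summable.sub (summable_qPoch_mul_pow hq m fun n => ?_) ?_
    · exact (hn n).trans (Nat.le_add_right _ _)
    · simp only [mul_assoc, ← pow_add]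
      simp only [← mul_assoc]
      refine summable_qPoch_mul_pow hq m fun n => ?_
      exact (hn n).trans ((Nat.le_add_right _ _).trans (Nat.le_add_right _ _))

theorem norm_thetaTerm_le {k : ℕ} {q : ℂ} (hq : ‖q‖ < 1) {a : ℕ} {m n e : ℕ}
    (he : e ≤ (k + 1) * n ^ 2 + n + (m + 1) * k * n - a * n) :
    ‖thetaTerm k q m a n‖ ≤ 2 * Real.exp (1 / (1 - ‖q ^ 2‖)) * ‖q‖ ^ e := by
  have h2 : ∀ j, e ≤ j → ‖q ^ j‖ ≤ ‖q‖ ^ e := fun j hj => by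
    rw [norm_pow]; exact pow_le_pow_of_le_one (norm_nonneg q) hq.le hj
  rw [thetaTerm, norm_mul, norm_mul, norm_pow, norm_neg, norm_one, one_pow, one_mul]
  calc _ ≤ Real.exp (1 / (1 - ‖q ^ 2‖)) * (‖q‖ ^ e + ‖q‖ ^ e) := by
        refine mul_le_mul (norm_qPoch_sq_le hq m n) ((norm_sub_le _ _).trans ?_)
          (norm_nonneg _) (Real.exp_nonneg _)
        exact add_le_add (h2 _ he) (h2 _ (by omega))
    _ = _ := by ring

theorem thetaSeries_tendsto {k : ℕ} (hk : 1 ≤ k) {q : ℂ} (hq : ‖q‖ < 1) {a : ℕ} (ha : 1 ≤ a)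
    (h : a ≤ k + 1) :
    Tendsto (fun m => thetaSeries k q m a) atTop (𝓝 (qPochInf (q ^ 2) (q ^ 2))) := by
  have hq2 : ‖q ^ 2‖ < 1 := by
    rw [norm_pow]; exact pow_lt_one₀ (norm_nonneg q) hq two_ne_zero
  rw [← tsum_ite_eq (0 : ℕ) (fun _ => qPochInf (q ^ 2) (q ^ 2))]
  refine tendsto_tsum_of_dominated_convergence
    (bound := fun n => 2 * Real.exp (1 / (1 - ‖q ^ 2‖)) * ‖q‖ ^ n) ?_ ?_ ?_
  · exact (summable_geometric_of_lt_one (norm_nonneg q) hq).mul_left _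
  · intro n
    rcases Nat.eq_zero_or_pos n with rfl | hn
    · have h1 : Tendsto (fun m => q ^ (a * (m + 1))) atTop (𝓝 0) := by
        refine (tendsto_pow_atTop_nhds_zero_of_norm_lt_one hq).comp ?_
        refine tendsto_atTop_mono (fun m => ?_) tendsto_id
        simp only [id]; nlinarith
      have := (qPoch_tendsto hq2 (q ^ 2)).mul (tendsto_const_nhds (x := (1 : ℂ)).sub h1)
      simpa [thetaTerm] using this
    · rw [if_neg hn.ne']
      refine squeeze_zero_norm
        (a := fun m => 2 * Real.exp (1 / (1 - ‖q ^ 2‖)) * ‖q‖ ^ m) (fun m => ?_) ?_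
      · refine norm_thetaTerm_le hq ?_
        have h2 := mul_le_mul_sq h n
        have h3 : m ≤ (m + 1) * k * n := by
          calc m ≤ (m + 1) * 1 * 1 := by omega
            _ ≤ (m + 1) * k * n := Nat.mul_le_mul (Nat.mul_le_mul le_rfl hk) hn
        omega
      · have := (tendsto_pow_atTop_nhds_zero_of_lt_one (norm_nonneg q) hq).const_mul
          (2 * Real.exp (1 / (1 - ‖q ^ 2‖)))
        rwa [mul_zero] at this
  · exact Eventually.of_forall fun m n => norm_thetaTerm_le hq (le_theta_exponent h m n)

theorem qPochInf_eq_mul {p : ℂ} (hp : ‖p‖ < 1) (x : ℂ) :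
    qPochInf p x = (1 - x) * qPochInf p (x * p) := by
  have h : Tendsto (fun n => qPoch p x (n + 1)) atTop (𝓝 ((1 - x) * qPochInf p (x * p))) := by
    refine ((qPoch_tendsto hp (x * p)).const_mul (1 - x)).congr fun n => ?_
    rw [qPoch, qPoch, Finset.prod_range_succ', mul_comm, pow_zero, mul_one]
    congr 1
    refine Finset.prod_congr rfl fun j _ => ?_
    ring
  exact tendsto_nhds_unique ((tendsto_add_atTop_iff_nat 1).mpr (qPoch_tendsto hp x)) h

theorem qPochInf_tendsto_one {p : ℂ} (hp : ‖p‖ < 1) {u : ℕ → ℂ} (hu : Tendsto u atTop (𝓝 0)) :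
    Tendsto (fun m => qPochInf p (u m)) atTop (𝓝 1) := by
  obtain ⟨C, hC, hC'⟩ := exists_norm_le_of_tendsto hu
  have := tendsto_tprod_one_add_of_dominated_convergence (𝓕 := atTop)
    (f := fun m (j : ℕ) => -(u m * p ^ j)) (g := fun _ => 0) (bound := fun j => C * ‖p‖ ^ j)
    ((summable_geometric_of_lt_one (norm_nonneg p) hp).mul_left C)
    (fun j => by simpa using (hu.mul_const (p ^ j)).neg)
    (Eventually.of_forall fun m j => by
      rw [norm_neg, norm_mul, norm_pow]
      gcongr
      exact hC' m)
  simp only [← sub_eq_add_neg, add_zero, tprod_one] at this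
  exact this

/-- The closed form of the generating function of the partitions with parts exceeding `m`,
with at most `a - 1` parts equal to `m + 1`. -/
noncomputable def closedForm (k : ℕ) (q : ℂ) (m a : ℕ) : ℂ :=
  if Even m then
    qPochInf (q ^ 2) (-q ^ (m + 1)) / qPochInf (q ^ 2) (q ^ 2) * thetaSeries k q m a
  else
    qPochInf (q ^ 2) (-q ^ (m + 2)) / qPochInf (q ^ 2) (q ^ 2) *
      thetaSeries k q m (2 * ((a + 1) / 2))

/-- The admissible multiplicities below `a` of the part `m + 1`. -/
def multiplicities (m a : ℕ) : Finset ℕ :=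
  (Finset.range a).filter fun f => Even (m + 1) → Even f

theorem sum_multiplicities_of_even {m : ℕ} (hm : Even m) (a : ℕ) (g : ℕ → ℂ) :
    ∑ f ∈ multiplicities m a, g f = ∑ f ∈ Finset.range a, g f := by
  rw [multiplicities, Finset.filter_true_of_mem]
  intro f _ h
  exact absurd h (by simpa [Nat.even_add_one] using hm)

theorem sum_multiplicities_of_odd {m : ℕ} (hm : ¬ Even m) (a : ℕ) (g : ℕ → ℂ) :
    ∑ f ∈ multiplicities m a, g f = ∑ j ∈ Finset.range ((a + 1) / 2), g (2 * j) := by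
  have hm' : Even (m + 1) := by simpa [Nat.even_add_one] using hm
  rw [← Finset.sum_image (g := fun j => 2 * j) (by intro x _ y _ h; simpa using h)]
  congr 1
  ext f
  simp only [multiplicities, Finset.mem_filter, Finset.mem_range, Finset.mem_image, hm',
    forall_const]
  constructor
  · rintro ⟨h1, c, hc⟩
    exact ⟨c, by omega, by omega⟩
  · rintro ⟨c, h1, rfl⟩
    exact ⟨by omega, even_two_mul c⟩

theorem thetaSeries_two_mul {k : ℕ} {q : ℂ} (hq : ‖q‖ < 1) (m : ℕ) {A : ℕ} (h : 2 * A ≤ k + 1) :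
    thetaSeries k q m (2 * A) =
      ∑ j ∈ Finset.range A, q ^ ((m + 1) * (2 * j)) * thetaSeries k q (m + 1) (k - 2 * j) := by
  induction A with
  | zero => simp [thetaSeries_zero]
  | succ A ih =>
    have := thetaSeries_add_two hq (show 2 * A + 1 ≤ k by omega) m
    rw [Finset.sum_range_succ, ← ih (by omega), ← this]
    ring_nf

theorem one_add_mul_thetaSeries {k : ℕ} {q : ℂ} (hq : ‖q‖ < 1) (m a : ℕ) (h : a ≤ k + 1)
    (hpar : a % 2 = k % 2) :
    (1 + q ^ (m + 1)) * thetaSeries k q m a =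
      ∑ f ∈ Finset.range a, q ^ ((m + 1) * f) *
        thetaSeries k q (m + 1) (2 * ((k - f + 1) / 2)) := by
  induction a using Nat.twoStepInduction with
  | zero => simp [thetaSeries_zero]
  | one =>
    have e : 2 * ((k - 0 + 1) / 2) = k + 1 := by omega
    rw [thetaSeries_one hq, Finset.sum_range_one, e]
    simp
  | more a ih _ =>
    have := thetaSeries_add_two hq (show a + 1 ≤ k by omega) m
    have e1 : 2 * ((k - a + 1) / 2) = k - a := by omega
    have e2 : 2 * ((k - (a + 1) + 1) / 2) = k - a := by omega
    rw [Finset.sum_range_succ, Finset.sum_range_succ, ← ih (by omega) (by omega), e1, e2,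
      eq_add_of_sub_eq this]
    ring

/-- The pairs of level and bound for which `closedForm` is the generating function. -/
def Admissible (k m a : ℕ) : Prop := 1 ≤ a ∧ a ≤ k ∧ (Even m → a % 2 = k % 2)

theorem Admissible.sub {k m a f : ℕ} (h : Admissible k m a) (hf : f ∈ multiplicities m a) :
    Admissible k (m + 1) (k - f) := by
  obtain ⟨h1, h2, -⟩ := h
  simp only [multiplicities, Finset.mem_filter, Finset.mem_range] at hf
  refine ⟨by omega, by omega, fun hm => ?_⟩
  obtain ⟨c, hc⟩ := hf.2 hm
  omega

theorem closedForm_eq_sum {k : ℕ} {q : ℂ} (hq : ‖q‖ < 1) {m a : ℕ} (h : Admissible k m a) :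
    closedForm k q m a =
      ∑ f ∈ multiplicities m a, q ^ ((m + 1) * f) * closedForm k q (m + 1) (k - f) := by
  have hq2 : ‖q ^ 2‖ < 1 := by
    rw [norm_pow]; exact pow_lt_one₀ (norm_nonneg q) hq two_ne_zero
  obtain ⟨h1, h2, h3⟩ := h
  by_cases hm : Even m
  · have hm' : ¬ Even (m + 1) := by simpa [Nat.even_add_one] using hm
    have e : qPochInf (q ^ 2) (-q ^ (m + 1)) =
        (1 + q ^ (m + 1)) * qPochInf (q ^ 2) (-q ^ (m + 1 + 2)) := by
      rw [qPochInf_eq_mul hq2]; ring_nf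
    rw [sum_multiplicities_of_even hm]
    simp only [closedForm, if_pos hm, if_neg hm']
    calc _ = qPochInf (q ^ 2) (-q ^ (m + 1 + 2)) / qPochInf (q ^ 2) (q ^ 2) *
          ((1 + q ^ (m + 1)) * thetaSeries k q m a) := by rw [e]; ring
      _ = _ := by
        rw [one_add_mul_thetaSeries hq m a (by omega) (h3 hm), Finset.mul_sum]
        exact Finset.sum_congr rfl fun f _ => by ring
  · have hm' : Even (m + 1) := by simpa [Nat.even_add_one] using hm
    rw [sum_multiplicities_of_odd hm]
    simp only [closedForm, if_pos hm', if_neg hm]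
    rw [thetaSeries_two_mul hq m (by omega), Finset.mul_sum]
    exact Finset.sum_congr rfl fun f _ => by ring

theorem closedForm_tendsto {k : ℕ} (hk : 1 ≤ k) {q : ℂ} (hq : ‖q‖ < 1) {a : ℕ} (ha : 1 ≤ a)
    (hak : a ≤ k) : Tendsto (fun m => closedForm k q m a) atTop (𝓝 1) := by
  have hq2 : ‖q ^ 2‖ < 1 := by
    rw [norm_pow]; exact pow_lt_one₀ (norm_nonneg q) hq two_ne_zero
  have h0 := qPochInf_ne_zero hq2 hq2
  have hpow : ∀ i, Tendsto (fun m => -q ^ (m + i)) atTop (𝓝 0) := fun i => by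
    simpa using ((tendsto_add_atTop_iff_nat i).mpr
      (tendsto_pow_atTop_nhds_zero_of_norm_lt_one hq)).neg
  have key : ∀ i b, 1 ≤ b → b ≤ k + 1 → Tendsto (fun m => qPochInf (q ^ 2) (-q ^ (m + i)) /
      qPochInf (q ^ 2) (q ^ 2) * thetaSeries k q m b) atTop (𝓝 1) := fun i b hb hb' => by
    have := ((qPochInf_tendsto_one hq2 (hpow i)).div_const
      (qPochInf (q ^ 2) (q ^ 2))).mul (thetaSeries_tendsto hk hq hb hb')
    rwa [one_div, inv_mul_cancel₀ h0] at this
  exact (key 1 a ha (by omega)).if' (key 2 (2 * ((a + 1) / 2)) (by omega) (by omega))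

/-- The generating polynomial of the partitions with parts in `(m, m + d]`. -/
noncomputable def truncSum (k : ℕ) (q : ℂ) : ℕ → ℕ → ℕ → ℂ
  | 0, _, _ => 1
  | d + 1, m, a => ∑ f ∈ multiplicities m a, q ^ ((m + 1) * f) * truncSum k q d (m + 1) (k - f)

theorem sum_norm_pow_multiplicities_le {q : ℂ} (hq : ‖q‖ < 1) {k a : ℕ} (m : ℕ) (hak : a ≤ k) :
    ∑ f ∈ multiplicities m a, ‖q ^ ((m + 1) * f)‖ ≤ Real.exp (k * ‖q‖ ^ (m + 1)) := by
  have h1 : ∑ f ∈ multiplicities m a, ‖q ^ ((m + 1) * f)‖ ≤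
      ∑ f ∈ Finset.range (k + 1), ‖q ^ ((m + 1) * f)‖ := by
    refine Finset.sum_le_sum_of_subset_of_nonneg (fun f hf => ?_) fun _ _ _ => norm_nonneg _
    simp only [multiplicities, Finset.mem_filter, Finset.mem_range] at hf ⊢
    omega
  refine h1.trans ?_
  rw [Finset.sum_range_succ', mul_zero, pow_zero, norm_one]
  refine le_trans ?_ (Real.add_one_le_exp _)
  gcongr
  calc ∑ f ∈ Finset.range k, ‖q ^ ((m + 1) * (f + 1))‖
      ≤ ∑ f ∈ Finset.range k, ‖q‖ ^ (m + 1) := by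
        refine Finset.sum_le_sum fun f _ => ?_
        rw [norm_pow]
        exact pow_le_pow_of_le_one (norm_nonneg q) hq.le (Nat.le_mul_of_pos_right _ (by omega))
    _ = k * ‖q‖ ^ (m + 1) := by simp

/-- Any solution of the recurrence is approximated by the truncated sums. -/
theorem norm_truncSum_sub_le {k : ℕ} {q : ℂ} (hq : ‖q‖ < 1) {u : ℕ → ℕ → ℂ}
    (hu : ∀ m a, Admissible k m a →
      u m a = ∑ f ∈ multiplicities m a, q ^ ((m + 1) * f) * u (m + 1) (k - f))
    {ε : ℝ} (d m a : ℕ) (h : Admissible k m a)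
    (hε : ∀ b, Admissible k (m + d) b → ‖1 - u (m + d) b‖ ≤ ε) :
    ‖truncSum k q d m a - u m a‖ ≤ Real.exp (k * (‖q‖ ^ (m + 1) / (1 - ‖q‖))) * ε := by
  have hq1 : 0 < 1 - ‖q‖ := by linarith
  induction d generalizing m a with
  | zero =>
    have h1 := hε a h
    have h2 : 1 ≤ Real.exp (k * (‖q‖ ^ (m + 1) / (1 - ‖q‖))) := Real.one_le_exp (by positivity)
    exact h1.trans (le_mul_of_one_le_left ((norm_nonneg _).trans h1) h2)
  | succ d ih =>
    have hε' : ∀ b, Admissible k (m + 1 + d) b → ‖1 - u (m + 1 + d) b‖ ≤ ε := by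
      rw [show m + 1 + d = m + (d + 1) by ring]; exact hε
    rw [truncSum, hu m a h, ← Finset.sum_sub_distrib]
    calc _ ≤ ∑ f ∈ multiplicities m a, ‖q ^ ((m + 1) * f)‖ *
          (Real.exp (k * (‖q‖ ^ (m + 1 + 1) / (1 - ‖q‖))) * ε) := by
          refine norm_sum_le_of_le _ fun f hf => ?_
          rw [← mul_sub, norm_mul]
          gcongr
          exact ih (m + 1) (k - f) (h.sub hf) hε'
      _ ≤ Real.exp (k * ‖q‖ ^ (m + 1)) *
          (Real.exp (k * (‖q‖ ^ (m + 1 + 1) / (1 - ‖q‖))) * ε) := by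
          rw [← Finset.sum_mul]
          by_cases hne : (multiplicities m a).Nonempty
          · obtain ⟨f, hf⟩ := hne
            have h0 : 0 ≤ Real.exp (k * (‖q‖ ^ (m + 1 + 1) / (1 - ‖q‖))) * ε :=
              (norm_nonneg _).trans (ih (m + 1) (k - f) (h.sub hf) hε')
            exact mul_le_mul_of_nonneg_right (sum_norm_pow_multiplicities_le hq m h.2.1) h0
          · refine absurd ⟨0, ?_⟩ hne
            simp only [multiplicities, Finset.mem_filter, Finset.mem_range]
            exact ⟨h.1, fun _ => Even.zero⟩
      _ = _ := by
          rw [← mul_assoc, ← Real.exp_add]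
          congr 2
          field_simp
          ring

theorem norm_truncSum_le {k : ℕ} {q : ℂ} (hq : ‖q‖ < 1) (d m a : ℕ) (h : Admissible k m a) :
    ‖truncSum k q d m a‖ ≤ Real.exp (k * (‖q‖ ^ (m + 1) / (1 - ‖q‖))) := by
  have := norm_truncSum_sub_le hq (u := fun _ _ => 0) (ε := 1) (by simp) d m a h (by simp)
  simpa using this

theorem truncSum_tendsto {k : ℕ} {q : ℂ} (hq : ‖q‖ < 1) {a : ℕ} (h : Admissible k 0 a) :
    Tendsto (fun N => truncSum k q N 0 a) atTop (𝓝 (closedForm k q 0 a)) := by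
  have hk : 1 ≤ k := h.1.trans h.2.1
  rw [Metric.tendsto_atTop']
  intro δ hδ
  set B := Real.exp (k * (‖q‖ ^ (0 + 1) / (1 - ‖q‖))) with hB
  have hBpos : 0 < B := Real.exp_pos _
  have h1 : ∀ᶠ N in atTop, ∀ b ∈ Finset.Icc 1 k, dist (closedForm k q N b) 1 < δ / (2 * B) := by
    rw [Filter.eventually_all_finset]
    intro b hb
    rw [Finset.mem_Icc] at hb
    exact (Metric.tendsto_nhds.mp (closedForm_tendsto hk hq hb.1 hb.2)) _ (by positivity)
  obtain ⟨N₀, hN₀⟩ := eventually_atTop.mp h1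
  refine ⟨N₀, fun N hN => ?_⟩
  rw [dist_eq_norm]
  refine (norm_truncSum_sub_le hq (fun m a => closedForm_eq_sum hq) (ε := δ / (2 * B)) N 0 a h
    fun b hb => ?_).trans_lt ?_
  · have := (hN₀ N hN.le b (Finset.mem_Icc.mpr ⟨hb.1, hb.2.1⟩)).le
    rwa [dist_eq_norm, norm_sub_rev, ← zero_add N] at this
  · rw [← hB]
    field_simp
    linarith

/-- The multiplicity conditions on a multiset of parts, all of which exceed `m`. -/
def IsAndrews (k m a : ℕ) (s : Multiset ℕ) : Prop :=
  (∀ i ∈ s, m < i) ∧ s.count (m + 1) < a ∧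
    (∀ i, m < i → s.count i + s.count (i + 1) < k) ∧ ∀ i, Even i → Even (s.count i)

/-- The multisets satisfying `IsAndrews k m a` with parts in `(m, m + d]`. -/
def truncFinset (k : ℕ) : ℕ → ℕ → ℕ → Finset (Multiset ℕ)
  | 0, _, _ => {0}
  | d + 1, m, a => (multiplicities m a).biUnion fun f =>
      (truncFinset k d (m + 1) (k - f)).image fun s => Multiset.replicate f (m + 1) + s

theorem mem_truncFinset {k : ℕ} (d : ℕ) {m a : ℕ} (ha : 1 ≤ a) (hak : a ≤ k) {s : Multiset ℕ} :
    s ∈ truncFinset k d m a ↔ IsAndrews k m a s ∧ ∀ i ∈ s, i ≤ m + d := by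
  induction d generalizing m a s with
  | zero =>
    rw [truncFinset, Finset.mem_singleton]
    constructor
    · rintro rfl
      exact ⟨⟨by simp, by simp; omega, by simp; omega, by simp⟩, by simp⟩
    · rintro ⟨⟨h1, -⟩, h2⟩
      refine Multiset.eq_zero_of_forall_notMem fun i hi => ?_
      have := h1 i hi
      have := h2 i hi
      omega
  | succ d ih =>
    simp only [truncFinset, Finset.mem_biUnion, Finset.mem_image]
    constructor
    · rintro ⟨f, hf, t, ht, rfl⟩
      simp only [multiplicities, Finset.mem_filter, Finset.mem_range] at hf
      obtain ⟨hfa, hfe⟩ := hf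
      rw [ih (by omega) (by omega)] at ht
      obtain ⟨⟨h1, h2, h3, h4⟩, h5⟩ := ht
      have hc : t.count (m + 1) = 0 :=
        Multiset.count_eq_zero.mpr fun hi => absurd (h1 _ hi) (lt_irrefl _)
      have hcount : ∀ i, (Multiset.replicate f (m + 1) + t).count i =
          if i = m + 1 then f else t.count i := by
        intro i
        rw [Multiset.count_add, Multiset.count_replicate]
        by_cases hi : i = m + 1
        · subst hi; simp [hc]
        · simp [hi, Ne.symm hi]
      refine ⟨⟨fun i hi => ?_, ?_, fun i hi => ?_, fun i hi => ?_⟩, fun i hi => ?_⟩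
      · rcases Multiset.mem_add.mp hi with hi | hi
        · rw [Multiset.eq_of_mem_replicate hi]; omega
        · have := h1 i hi; omega
      · rw [hcount, if_pos rfl]; exact hfa
      · rw [hcount, hcount, if_neg (show i + 1 ≠ m + 1 by omega)]
        split_ifs with h
        · subst h; omega
        · exact h3 i (by omega)
      · rw [hcount]
        split_ifs with h
        · subst h; exact hfe hi
        · exact h4 i hi
      · rcases Multiset.mem_add.mp hi with hi | hi
        · rw [Multiset.eq_of_mem_replicate hi]; omega
        · have := h5 i hi; omega
    · rintro ⟨⟨h1, h2, h3, h4⟩, h5⟩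
      refine ⟨s.count (m + 1), ?_, s.filter fun i => m + 1 ≠ i, ?_, ?_⟩
      · simp only [multiplicities, Finset.mem_filter, Finset.mem_range]
        exact ⟨h2, h4 _⟩
      · have hcount : ∀ i, i ≠ m + 1 → (s.filter fun i => m + 1 ≠ i).count i = s.count i :=
          fun i hi => Multiset.count_filter_of_pos (Ne.symm hi)
        have hc : (s.filter fun i => m + 1 ≠ i).count (m + 1) = 0 :=
          Multiset.count_filter_of_neg (by simp)
        have hk1 := h3 (m + 1) (by omega)
        rw [ih (by omega) (by omega)]
        refine ⟨⟨fun i hi => ?_, ?_, fun i hi => ?_, fun i hi => ?_⟩, fun i hi => ?_⟩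
        · obtain ⟨hi, hi'⟩ := Multiset.mem_filter.mp hi
          have := h1 i hi
          omega
        · rw [hcount _ (by omega)]; omega
        · rw [hcount _ (by omega), hcount _ (by omega)]
          exact h3 i (by omega)
        · by_cases h : i = m + 1
          · subst h; rw [hc]; exact Even.zero
          · rw [hcount i h]; exact h4 i hi
        · have := h5 i (Multiset.mem_filter.mp hi).1; omega
      · rw [← Multiset.filter_eq, Multiset.filter_add_not]

theorem sum_truncFinset {k : ℕ} (q : ℂ) (d : ℕ) {m a : ℕ} (hak : a ≤ k) :
    ∑ s ∈ truncFinset k d m a, q ^ s.sum = truncSum k q d m a := by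
  induction d generalizing m a with
  | zero => simp [truncFinset, truncSum]
  | succ d ih =>
    have hcount : ∀ f < a, ∀ t ∈ truncFinset k d (m + 1) (k - f),
        (Multiset.replicate f (m + 1) + t).count (m + 1) = f := by
      intro f hf t ht
      rw [mem_truncFinset d (by omega) (by omega)] at ht
      have hc : t.count (m + 1) = 0 :=
        Multiset.count_eq_zero.mpr fun hi => absurd (ht.1.1 _ hi) (lt_irrefl _)
      rw [Multiset.count_add, Multiset.count_replicate_self, hc, add_zero]
    have hlt : ∀ f ∈ multiplicities m a, f < a := fun f hf =>
      Finset.mem_range.mp (Finset.mem_filter.mp hf).1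
    rw [truncFinset, truncSum, Finset.sum_biUnion]
    · refine Finset.sum_congr rfl fun f hf => ?_
      rw [Finset.sum_image (fun s _ t _ h => add_left_cancel h), ← ih (by omega), Finset.mul_sum]
      refine Finset.sum_congr rfl fun s _ => ?_
      rw [Multiset.sum_add, Multiset.sum_replicate, pow_add, smul_eq_mul, mul_comm f]
    · intro f hf g hg hfg
      rw [Function.onFun, Finset.disjoint_left]
      intro s hs hs'
      obtain ⟨t, ht, rfl⟩ := Finset.mem_image.mp hs
      obtain ⟨t', ht', h⟩ := Finset.mem_image.mp hs'
      have h1 := hcount f (hlt f hf) t ht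
      have h2 := hcount g (hlt g hg) t' ht'
      rw [h] at h2
      exact hfg (h1.symm.trans h2)

theorem exists_subset_truncFinset {k a : ℕ} (ha : 1 ≤ a) (hak : a ≤ k)
    (u : Finset {s : Multiset ℕ // IsAndrews k 0 a s}) :
    ∃ N, u.map (Function.Embedding.subtype _) ⊆ truncFinset k N 0 a := by
  refine ⟨u.sup fun s => s.1.sum, fun s hs => ?_⟩
  obtain ⟨t, ht, rfl⟩ := Finset.mem_map.mp hs
  refine (mem_truncFinset _ ha hak).mpr ⟨t.2, fun i hi => ?_⟩
  rw [zero_add]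
  exact (Multiset.le_sum_of_mem hi).trans
    (Finset.le_sup (f := fun s : {s : Multiset ℕ // IsAndrews k 0 a s} => s.1.sum) ht)

theorem summable_norm_andrews {k a : ℕ} (h : Admissible k 0 a) {q : ℂ} (hq : ‖q‖ < 1) :
    Summable fun s : {s : Multiset ℕ // IsAndrews k 0 a s} => ‖q ^ s.1.sum‖ := by
  have hr : ‖((‖q‖ : ℝ) : ℂ)‖ < 1 := by simpa using hq
  refine summable_of_sum_le (c := Real.exp (k * (‖((‖q‖ : ℝ) : ℂ)‖ ^ (0 + 1) /
    (1 - ‖((‖q‖ : ℝ) : ℂ)‖)))) (fun _ => norm_nonneg _) fun u => ?_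
  obtain ⟨N, hN⟩ := exists_subset_truncFinset h.1 h.2.1 u
  have h1 : ∑ s ∈ u, ‖q ^ s.1.sum‖ ≤ ∑ s ∈ truncFinset k N 0 a, ‖q‖ ^ s.sum := by
    refine le_trans (le_of_eq ?_) (Finset.sum_le_sum_of_subset_of_nonneg hN
      fun _ _ _ => by positivity)
    simp [Finset.sum_map]
  have h2 : ((∑ s ∈ truncFinset k N 0 a, ‖q‖ ^ s.sum : ℝ) : ℂ) =
      truncSum k ((‖q‖ : ℝ) : ℂ) N 0 a := by
    rw [← sum_truncFinset _ _ h.2.1]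
    push_cast
    rfl
  refine h1.trans ((le_abs_self _).trans ?_)
  rw [← Real.norm_eq_abs, ← Complex.norm_real, h2]
  exact norm_truncSum_le hr N 0 a h

theorem hasSum_andrews {k a : ℕ} (h : Admissible k 0 a) {q : ℂ} (hq : ‖q‖ < 1) :
    HasSum (fun s : {s : Multiset ℕ // IsAndrews k 0 a s} => q ^ s.1.sum)
      (closedForm k q 0 a) := by
  classical
  have hs := (summable_norm_andrews h hq).of_norm.hasSum
  let S : ℕ → Finset {s : Multiset ℕ // IsAndrews k 0 a s} := fun N =>
    (truncFinset k N 0 a).subtype _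
  have hmem : ∀ N s, s ∈ S N ↔ ∀ i ∈ s.1, i ≤ 0 + N := fun N s => by
    rw [Finset.mem_subtype, mem_truncFinset N h.1 h.2.1]
    exact and_iff_right s.2
  have hS : Tendsto S atTop atTop := by
    refine tendsto_atTop_finset_of_monotone (fun M N hMN s hs => ?_) fun s => ?_
    · rw [hmem] at hs ⊢
      exact fun i hi => (hs i hi).trans (by omega)
    · refine ⟨s.1.sum, (hmem _ _).mpr fun i hi => ?_⟩
      rw [zero_add]
      exact Multiset.le_sum_of_mem hi
  have h1 := (hs.comp hS).congr (f₂ := fun N => truncSum k q N 0 a) fun N => by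
    rw [← sum_truncFinset q N h.2.1, Function.comp_apply]
    refine (Finset.sum_subtype_of_mem (fun s : Multiset ℕ => q ^ s.sum) fun s hs => ?_)
    exact ((mem_truncFinset N h.1 h.2.1).mp hs).1
  rw [← tendsto_nhds_unique h1 (truncSum_tendsto hq h)]
  exact hs

/-- Partitions of `n` with the multiplicity conditions, as multisets. -/
def andrewsPartitionEquiv {k a : ℕ} (ha : 1 ≤ a) (hak : a ≤ k) (n : ℕ) :
    {s : {s : Multiset ℕ // IsAndrews k 0 a s} // s.1.sum = n} ≃
      {P : n.Partition // P.parts.count 1 ≤ a - 1 ∧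
        (∀ i : ℕ, 1 ≤ i → P.parts.count i + P.parts.count (i + 1) ≤ k - 1) ∧
        ∀ j : ℕ, 1 ≤ j → Even (P.parts.count (2 * j))} where
  toFun s := ⟨⟨s.1.1, fun hi => s.1.2.1 _ hi, s.2⟩, by
    obtain ⟨⟨s, h1, h2, h3, h4⟩, h5⟩ := s
    refine ⟨?_, fun i hi => ?_, fun j _ => h4 _ (even_two_mul j)⟩
    · simp only [zero_add] at h2 ⊢; omega
    · have := h3 i hi
      simp only; omega⟩
  invFun P := ⟨⟨P.1.parts, by
    obtain ⟨P, h2, h3, h4⟩ := P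
    refine ⟨fun i hi => P.parts_pos hi, ?_, fun i hi => ?_, fun i hi => ?_⟩
    · simp only [zero_add]; omega
    · have := h3 i hi
      simp only; omega
    · obtain ⟨j, rfl⟩ := hi.two_dvd
      rcases Nat.eq_zero_or_pos j with rfl | hj
      · have : Multiset.count (2 * 0) P.parts = 0 :=
          Multiset.count_eq_zero.mpr fun h => absurd (P.parts_pos h) (by simp)
        simp only [this]
        exact Even.zero
      · exact h4 j hj⟩, P.1.parts_sum⟩
  left_inv _ := rfl
  right_inv _ := rfl

theorem thetaSeries_level_zero {k a : ℕ} (ha : 1 ≤ a) (hak : a ≤ k) {q : ℂ} (hq : ‖q‖ < 1) :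
    thetaSeries k q 0 a =
      qPochInf (q ^ (2 * k + 2)) (q ^ a) * qPochInf (q ^ (2 * k + 2)) (q ^ (2 * k + 2 - a)) *
        qPochInf (q ^ (2 * k + 2)) (q ^ (2 * k + 2)) := by
  have hpow : ∀ j, 1 ≤ j → ‖q ^ j‖ < 1 := fun j hj => by
    rw [norm_pow]; exact pow_lt_one₀ (norm_nonneg q) hq (by omega)
  rcases eq_or_ne q 0 with rfl | hq0
  · have h1 : ∀ x : ℂ, qPochInf 0 x = 1 - x := fun x => by
      rw [qPochInf_eq_mul (by simp), mul_zero]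
      simp [qPochInf]
    have e : ∀ j, 1 ≤ j → (0 : ℂ) ^ j = 0 := fun j hj => zero_pow (by omega)
    rw [e _ (show 1 ≤ 2 * k + 2 by omega), e _ ha, e _ (show 1 ≤ 2 * k + 2 - a by omega), h1,
      thetaSeries, tsum_eq_single 0]
    · simp [thetaTerm, qPoch]; omega
    · intro n hn
      have h2 := le_theta_exponent (show a ≤ k + 1 by omega) 0 n
      rw [thetaTerm, e ((k + 1) * n ^ 2 + n + (0 + 1) * k * n - a * n) (by omega),
        e ((k + 1) * n ^ 2 + n + (0 + 1) * k * n + a * (n + 0 + 1)) (by omega), sub_zero, mul_zero]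
  · rw [← jacobi_triple_product (hpow _ (by omega)) (pow_ne_zero _ hq0) (hpow a ha)
      (hpow _ (by omega)) (by rw [← pow_add]; congr 1; omega), thetaSeries]
    refine tsum_congr fun n => ?_
    have hc := choose_two_mul_two_add n
    obtain ⟨b, rfl⟩ : ∃ b, k = a + b := ⟨k - a, by omega⟩
    have e1 : 2 * (a + b) + 2 - a = a + 2 * b + 2 := by omega
    rw [thetaTerm, choose_two_succ, e1]
    simp only [← pow_mul, ← pow_add, qPoch, Finset.range_zero, Finset.prod_empty, mul_one]
    congr 3
    · apply Nat.sub_eq_of_eq_add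
      rw [← hc]; ring
    · rw [← hc]; ring

/-- Andrews' theorem: generating function for `W_{k,a}(n)` when `k ≡ a (mod 2)`. -/
theorem andrews_W_same_parity (k a : ℕ) (ha : 1 ≤ a) (hak : a ≤ k)
    (hpar : k % 2 = a % 2) (q : ℂ) (hq : ‖q‖ < 1) :
    Summable (fun n : ℕ =>
      (Nat.card {P : n.Partition //
          P.parts.count 1 ≤ a - 1 ∧
          (∀ i : ℕ, 1 ≤ i → P.parts.count i + P.parts.count (i + 1) ≤ k - 1) ∧
          ∀ j : ℕ, 1 ≤ j → Even (P.parts.count (2 * j))} : ℂ) * q ^ n) ∧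
    ∑' n : ℕ,
      (Nat.card {P : n.Partition //
          P.parts.count 1 ≤ a - 1 ∧
          (∀ i : ℕ, 1 ≤ i → P.parts.count i + P.parts.count (i + 1) ≤ k - 1) ∧
          ∀ j : ℕ, 1 ≤ j → Even (P.parts.count (2 * j))} : ℂ) * q ^ n =
      qPochInf (q ^ 2) (-q) * qPochInf (q ^ (2 * k + 2)) (q ^ a) *
        qPochInf (q ^ (2 * k + 2)) (q ^ (2 * k + 2 - a)) *
        qPochInf (q ^ (2 * k + 2)) (q ^ (2 * k + 2)) / qPochInf (q ^ 2) (q ^ 2) := by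
  have h : Admissible k 0 a := ⟨ha, hak, fun _ => hpar.symm⟩
  have hsig := (Equiv.sigmaFiberEquiv
    fun s : {s : Multiset ℕ // IsAndrews k 0 a s} => s.1.sum).hasSum_iff.mpr (hasSum_andrews h hq)
  have hsum := hsig.sigma (g := fun n : ℕ => (Nat.card {P : n.Partition //
          P.parts.count 1 ≤ a - 1 ∧
          (∀ i : ℕ, 1 ≤ i → P.parts.count i + P.parts.count (i + 1) ≤ k - 1) ∧
          ∀ j : ℕ, 1 ≤ j → Even (P.parts.count (2 * j))} : ℂ) * q ^ n) fun n => by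
    have : Finite {s : {s : Multiset ℕ // IsAndrews k 0 a s} // s.1.sum = n} :=
      Finite.of_equiv _ (andrewsPartitionEquiv ha hak n).symm
    have := Fintype.ofFinite {s : {s : Multiset ℕ // IsAndrews k 0 a s} // s.1.sum = n}
    rw [← Nat.card_congr (andrewsPartitionEquiv ha hak n), Nat.card_eq_fintype_card]
    have hf := hasSum_fintype
      (fun s : {s : {s : Multiset ℕ // IsAndrews k 0 a s} // s.1.sum = n} => q ^ s.1.1.sum)
    have hconst : ∀ s ∈ (Finset.univ :
        Finset {s : {s : Multiset ℕ // IsAndrews k 0 a s} // s.1.sum = n}),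
        q ^ s.1.1.sum = q ^ n := fun s _ => by rw [s.2]
    rw [Finset.sum_congr rfl hconst, Finset.sum_const, nsmul_eq_mul, Finset.card_univ] at hf
    exact hf
  refine ⟨hsum.summable, hsum.tsum_eq.trans ?_⟩
  rw [closedForm, if_pos Even.zero, thetaSeries_level_zero ha hak hq, zero_add, pow_one]
  ring
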